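/- arXiv:math/0404376 — 3 statements merged into one kernel-verified Lean document; each statement's English description precedes it below -/
import Mathlib

section
/- Let H be a complex Hilbert space, X a nonzero closed linear subspace of B(H), and φ : X × X → X a bilinear map that is completely contractive in the Christensen–Sinclair sense: for every n ∈ ℕ and all n×n matrices a = (a_{ij}) and b = (b_{ij}) with entries in X, ‖(∑_k φ(a_{ik}, b_{kj}))_{ij}‖ ≤ ‖a‖·‖b‖ in Mₙ(B(H)). Suppose there exist nets (e_α) and (f_β) in X with ‖e_α‖ ≤ 1 and ‖f_β‖ ≤ 1 for all indices, such that φ(x, e_α) → x and φ(f_β, x) → x in norm for every x ∈ X. Then (X, φ) has a two-sided contractive approximate identity: there exists a single net (g_γ) in X with ‖g_γ‖ ≤ 1 for all γ such that φ(x, g_γ) → x and φ(g_γ, x) → x in norm for every x ∈ X. -/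
open scoped Matrix

/-- The unique C*-algebra norm on `n × n` matrices over a (unital) C*-algebra `B`,
given by the purely algebraic-analytic formula `‖M‖ = √(spectralRadius (Mᴴ * M))`,
which is the unique C*-norm since `Mₙ(B)` is a C*-algebra and in any C*-algebra
`‖a‖² = ‖a⋆a‖ = r(a⋆a)`. -/
noncomputable def cstarMatrixNorm {B : Type*} [Ring B] [StarRing B] [Algebra ℂ B]
    {n : ℕ} (M : Matrix (Fin n) (Fin n) B) : ℝ :=
  Real.sqrt ((spectralRadius ℂ (star M * M)).toReal)

section MatrixNorm

/-- The corner embedding of a C⋆-algebra into its matrix algebra. -/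
def cornerStarHom (A : Type*) [CStarAlgebra A] (n : ℕ) :
    A →⋆ₙₐ[ℂ] CStarMatrix (Fin (n + 1)) (Fin (n + 1)) A where
  toFun a := CStarMatrix.ofMatrix (Matrix.single 0 0 a)
  map_smul' c a := by
    ext i j
    simp [Matrix.single_apply]
  map_zero' := by
    ext i j
    simp
  map_add' a b := by
    ext i j
    simp [Matrix.single_add]
  map_mul' a b := by
    ext i j
    simp [CStarMatrix.mul_apply, Matrix.single_apply, ite_and]
    grind
  map_star' a := by
    ext i j
    simp [CStarMatrix.star_apply, Matrix.single_apply, apply_ite star, and_comm]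

variable {A : Type*} [CStarAlgebra A] [PartialOrder A] [StarOrderedRing A]

theorem cstarMatrixNorm_eq_norm {n : ℕ} (M : Matrix (Fin n) (Fin n) A) :
    cstarMatrixNorm M = ‖CStarMatrix.ofMatrix M‖ := by
  have h1 : spectralRadius ℂ (star M * M) = spectralRadius ℂ
      (star (CStarMatrix.ofMatrix M) * CStarMatrix.ofMatrix M) := by
    unfold spectralRadius
    have := AlgEquiv.spectrum_eq (R := ℂ)
      (CStarMatrix.ofMatrixStarAlgEquiv (n := Fin n) (A := A)) (star M * M)
    rw [← this, map_mul, map_star]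
    rfl
  rw [cstarMatrixNorm, h1, (IsSelfAdjoint.star_mul_self _).spectralRadius_eq_nnnorm]
  simp [CStarRing.norm_star_mul_self]

theorem norm_ofMatrix_single_le {n : ℕ} (a : A) :
    ‖CStarMatrix.ofMatrix (Matrix.single (0 : Fin (n + 1)) (0 : Fin (n + 1)) a)‖ ≤ ‖a‖ :=
  NonUnitalStarAlgHom.norm_apply_le (cornerStarHom A n) a

theorem sq_cstarMatrixNorm_row_le {n : ℕ} (x : Fin (n + 1) → A) :
    cstarMatrixNorm (Matrix.of fun i k => if i = 0 then x k else 0) ^ 2 ≤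
      ‖∑ k, x k * star (x k)‖ := by
  rw [cstarMatrixNorm_eq_norm, sq, ← CStarRing.norm_self_mul_star]
  convert! norm_ofMatrix_single_le (n := n) (∑ k, x k * star (x k)) using 2
  ext i j
  by_cases hi : i = 0 <;> by_cases hj : j = 0 <;>
    simp [CStarMatrix.mul_apply, CStarMatrix.star_apply, hi, hj,
      eq_comm (a := (0 : Fin (n + 1)))]

theorem sq_cstarMatrixNorm_column_le {n : ℕ} (x : Fin (n + 1) → A) :
    cstarMatrixNorm (Matrix.of fun k j => if j = 0 then x k else 0) ^ 2 ≤
      ‖∑ k, star (x k) * x k‖ := by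
  rw [cstarMatrixNorm_eq_norm, sq, ← CStarRing.norm_star_mul_self]
  convert! norm_ofMatrix_single_le (n := n) (∑ k, star (x k) * x k) using 2
  ext i j
  by_cases hi : i = 0 <;> by_cases hj : j = 0 <;>
    simp [CStarMatrix.mul_apply, CStarMatrix.star_apply, hi, hj,
      eq_comm (a := (0 : Fin (n + 1)))]

theorem norm_apply_le_cstarMatrixNorm {n : ℕ} (M : Matrix (Fin n) (Fin n) A) (i j : Fin n) :
    ‖M i j‖ ≤ cstarMatrixNorm M := by
  rw [cstarMatrixNorm_eq_norm]
  exact CStarMatrix.norm_entry_le_norm (M := CStarMatrix.ofMatrix M)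

/-- A completely contractive bilinear map satisfies the Haagerup row-column estimate. -/
theorem sq_norm_sum_le_of_completelyContractive {X : Submodule ℂ A} (φ : X →ₗ[ℂ] X →ₗ[ℂ] X)
    (hφ : ∀ (n : ℕ) (a b : Matrix (Fin n) (Fin n) X),
      cstarMatrixNorm (Matrix.of fun i j => ((∑ k, φ (a i k) (b k j) : X) : A)) ≤
        cstarMatrixNorm (a.map (fun x => (x : A))) * cstarMatrixNorm (b.map (fun x => (x : A))))
    {ι : Type*} (s : Finset ι) (x y : ι → X) :
    ‖∑ i ∈ s, φ (x i) (y i)‖ ^ 2 ≤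
      ‖∑ i ∈ s, (x i : A) * star (x i : A)‖ * ‖∑ i ∈ s, star (y i : A) * (y i : A)‖ := by
  rcases s.eq_empty_or_nonempty with rfl | hs
  · simp
  obtain ⟨n, hn⟩ : ∃ n, s.card = n + 1 := ⟨s.card - 1, by have := hs.card_pos; omega⟩
  let E : Fin (n + 1) ≃ s := (s.equivFinOfCardEq hn).symm
  have key {M : Type _} [AddCommMonoid M] (g : ι → M) :
      ∑ i ∈ s, g i = ∑ k, g (E k) := by
    rw [← Finset.sum_coe_sort s g, E.sum_comp (fun i : s => g i)]
  rw [key, key, key]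
  have h := hφ (n + 1) (Matrix.of fun i k => if i = 0 then x (E k) else 0)
    (Matrix.of fun k j => if j = 0 then y (E k) else 0)
  have h0 := (norm_apply_le_cstarMatrixNorm _ 0 0).trans h
  have hx := sq_cstarMatrixNorm_row_le fun k => (x (E k) : A)
  have hy := sq_cstarMatrixNorm_column_le fun k => (y (E k) : A)
  simp only [Matrix.of_apply, if_true] at h0
  refine (pow_le_pow_left₀ (norm_nonneg _) h0 2).trans ?_
  rw [mul_pow]
  refine mul_le_mul (hx.trans' (le_of_eq ?_)) (hy.trans' (le_of_eq ?_)) (sq_nonneg _)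
    (norm_nonneg _)
  · congr 2
    ext i j
    by_cases hi : i = 0 <;> simp [hi]
  · congr 2
    ext i j
    by_cases hj : j = 0 <;> simp [hj]

end MatrixNorm

section DyadicSums

/-- The sum of `f` over the `m`-th dyadic block of length `2 ^ l`. -/
def blockSum {E : Type*} [Add E] (f : ℕ → E) : ℕ → ℕ → E
  | 0, m => f m
  | l + 1, m => blockSum f l (2 * m) + blockSum f l (2 * m + 1)

/-- The sum of `f` over the left halves of all dyadic subintervals of `[0, 2 ^ k)` of length
at least two. -/
def leftSum {E : Type*} [AddCommMonoid E] (f : ℕ → E) (k : ℕ) : E :=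
  ∑ l ∈ Finset.range k, ∑ m ∈ Finset.range (2 ^ (k - 1 - l)), blockSum f l (2 * m)

theorem sum_range_two_mul {M : Type*} [AddCommMonoid M] (g : ℕ → M) (n : ℕ) :
    ∑ i ∈ Finset.range (2 * n), g i = ∑ i ∈ Finset.range n, (g (2 * i) + g (2 * i + 1)) := by
  induction n with
  | zero => simp
  | succ n ih =>
    rw [mul_add, mul_one, Finset.sum_range_succ, Finset.sum_range_succ, ih,
      Finset.sum_range_succ, add_assoc]

/-- Parseval's identity for the Haar system. -/
theorem sum_haar_eq {E F : Type*} [AddCommGroup E] [AddCommGroup F] [Module ℝ F] (q : E → F)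
    (hq : ∀ a b, q (a + b) + q (a - b) = (2 : ℝ) • (q a + q b)) (f : ℕ → E) (k : ℕ) :
    ∑ l ∈ Finset.range k, ∑ m ∈ Finset.range (2 ^ (k - 1 - l)),
        ((2 : ℝ) ^ (l + 1))⁻¹ • q (blockSum f l (2 * m) - blockSum f l (2 * m + 1)) =
      ∑ j ∈ Finset.range (2 ^ k), q (f j) - ((2 : ℝ) ^ k)⁻¹ • q (blockSum f k 0) := by
  have h := Finset.sum_range_sub' (fun l => ∑ m ∈ Finset.range (2 ^ (k - l)),
    ((2 : ℝ) ^ l)⁻¹ • q (blockSum f l m)) k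
  simp only [tsub_self, tsub_zero, pow_zero, Finset.range_one, Finset.sum_singleton, inv_one,
    one_smul] at h
  refine Eq.trans (Finset.sum_congr rfl fun l hl => ?_) h
  have hl' : k - l = (k - 1 - l) + 1 := by have := Finset.mem_range.1 hl; omega
  have hl'' : k - (l + 1) = k - 1 - l := by omega
  rw [hl', hl'', pow_succ' (2 : ℕ), sum_range_two_mul, ← Finset.sum_sub_distrib]
  refine Finset.sum_congr rfl fun m _ => ?_
  have h1 := hq (blockSum f l (2 * m)) (blockSum f l (2 * m + 1))
  have h2 : ((2 : ℝ) ^ l)⁻¹ = ((2 : ℝ) ^ (l + 1))⁻¹ * 2 := by rw [pow_succ]; field_simp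
  rw [← smul_add, h2, mul_smul, ← h1, blockSum, smul_add, add_sub_cancel_left]

variable {E F : Type*} [NormedAddCommGroup E] [NormedSpace ℝ E] [NormedAddCommGroup F]
  [NormedSpace ℝ F] {ε : ℝ}

theorem norm_map_blockSum_sub_le (T : E →ₗ[ℝ] F) {f : ℕ → E} {x : F}
    (h : ∀ j, ‖T (f j) - x‖ ≤ ε) (l m : ℕ) :
    ‖T (blockSum f l m) - (2 : ℝ) ^ l • x‖ ≤ 2 ^ l * ε := by
  induction l generalizing m with
  | zero => simpa [blockSum] using h m
  | succ l ih =>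
    have : T (blockSum f (l + 1) m) - (2 : ℝ) ^ (l + 1) • x =
        (T (blockSum f l (2 * m)) - (2 : ℝ) ^ l • x) +
          (T (blockSum f l (2 * m + 1)) - (2 : ℝ) ^ l • x) := by
      rw [blockSum, map_add]
      module
    rw [this]
    refine (norm_add_le_of_le (ih _) (ih _)).trans (le_of_eq ?_)
    ring

theorem norm_blockSum_le {f : ℕ → E} (h : ∀ j, ‖f j‖ ≤ 1) (l m : ℕ) :
    ‖blockSum f l m‖ ≤ 2 ^ l := by
  simpa using norm_map_blockSum_sub_le (LinearMap.id : E →ₗ[ℝ] E) (f := f) (x := 0) (ε := 1)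
    (by simpa using h) l m

theorem sum_range_sum_range_two_pow (k : ℕ) (c : ℝ) :
    ∑ l ∈ Finset.range k, ∑ _m ∈ Finset.range (2 ^ (k - 1 - l)), (2 : ℝ) ^ l * c =
      k * 2 ^ (k - 1) * c := by
  have (l : ℕ) (hl : l ∈ Finset.range k) :
      ∑ _m ∈ Finset.range (2 ^ (k - 1 - l)), (2 : ℝ) ^ l * c = 2 ^ (k - 1) * c := by
    have hl' : k - 1 = (k - 1 - l) + l := by have := Finset.mem_range.1 hl; omega
    rw [Finset.sum_const, Finset.card_range, nsmul_eq_mul, ← mul_assoc]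
    push_cast
    rw [← pow_add, ← hl']
  rw [Finset.sum_congr rfl this]
  simp [mul_assoc]

theorem norm_map_leftSum_sub_le (T : E →ₗ[ℝ] F) {f : ℕ → E} {x : F}
    (h : ∀ j, ‖T (f j) - x‖ ≤ ε) (k : ℕ) :
    ‖T (leftSum f k) - ((k : ℝ) * 2 ^ (k - 1)) • x‖ ≤ k * 2 ^ (k - 1) * ε := by
  have hx : ((k : ℝ) * 2 ^ (k - 1)) • x =
      ∑ l ∈ Finset.range k, ∑ _m ∈ Finset.range (2 ^ (k - 1 - l)), (2 : ℝ) ^ l • x := by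
    have := sum_range_sum_range_two_pow k 1
    simp only [mul_one] at this
    rw [← this]
    simp only [Finset.sum_smul]
  rw [hx, leftSum, map_sum, ← sum_range_sum_range_two_pow, ← Finset.sum_sub_distrib]
  refine norm_sum_le_of_le _ fun l _ => ?_
  rw [map_sum, ← Finset.sum_sub_distrib]
  exact norm_sum_le_of_le _ fun m _ => norm_map_blockSum_sub_le T h _ _

theorem norm_map_average_sub_le (T : E →ₗ[ℝ] F) {f : ℕ → E} {x : F}
    (h : ∀ j, ‖T (f j) - x‖ ≤ ε) {k : ℕ} (hk : k ≠ 0) :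
    ‖T (((k : ℝ) * 2 ^ (k - 1))⁻¹ • leftSum f k) - x‖ ≤ ε := by
  have hc : (0 : ℝ) < k * 2 ^ (k - 1) := by positivity
  have := norm_map_leftSum_sub_le T h k
  rw [map_smul, ← inv_smul_smul₀ hc.ne' x, ← smul_sub, norm_smul, norm_inv,
    Real.norm_of_nonneg hc.le, inv_mul_le_iff₀ hc]
  simpa [hc.ne'] using this

theorem norm_bilin_blockSum_sub_le (ψ : E →ₗ[ℝ] F →ₗ[ℝ] E) {u : ℕ → E} {v : ℕ → F}
    (h : ∀ i j, i < j → ‖ψ (u i) (v j) - u i‖ ≤ ε) (l : ℕ) {m m' : ℕ} (hm : m < m') :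
    ‖ψ (blockSum u l m) (blockSum v l m') - (2 : ℝ) ^ l • blockSum u l m‖ ≤ 4 ^ l * ε := by
  induction l generalizing m m' with
  | zero => simpa [blockSum] using h m m' hm
  | succ l ih =>
    have : ψ (blockSum u (l + 1) m) (blockSum v (l + 1) m') -
          (2 : ℝ) ^ (l + 1) • blockSum u (l + 1) m =
        (ψ (blockSum u l (2 * m)) (blockSum v l (2 * m')) -
            (2 : ℝ) ^ l • blockSum u l (2 * m)) +
          (ψ (blockSum u l (2 * m)) (blockSum v l (2 * m' + 1)) -
            (2 : ℝ) ^ l • blockSum u l (2 * m)) +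
          ((ψ (blockSum u l (2 * m + 1)) (blockSum v l (2 * m')) -
            (2 : ℝ) ^ l • blockSum u l (2 * m + 1)) +
          (ψ (blockSum u l (2 * m + 1)) (blockSum v l (2 * m' + 1)) -
            (2 : ℝ) ^ l • blockSum u l (2 * m + 1))) := by
      simp only [blockSum, map_add, LinearMap.add_apply]
      module
    rw [this]
    refine (norm_add_le_of_le (norm_add_le_of_le (ih ?_) (ih ?_))
      (norm_add_le_of_le (ih ?_) (ih ?_))).trans (le_of_eq ?_)
    any_goals omega
    ring

end DyadicSums

section Haagerup

variable {A : Type*} [CStarAlgebra A]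

theorem norm_sum_blockSum_le {E : Type*} [NormedAddCommGroup E] [NormedSpace ℝ E] {q : E → A}
    (hq1 : ∀ a, ‖q a‖ ≤ ‖a‖ ^ 2) {f : ℕ → E} (hf : ∀ j, ‖f j‖ ≤ 1) (k : ℕ) :
    ‖∑ l ∈ Finset.range k, ∑ m ∈ Finset.range (2 ^ (k - 1 - l)),
      ((2 : ℝ) ^ (l + 1))⁻¹ • q (blockSum f l (2 * m) + blockSum f l (2 * m + 1))‖ ≤
        k * 2 ^ k := by
  have hk : (k : ℝ) * 2 ^ k = k * 2 ^ (k - 1) * 2 := by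
    rcases k with _ | k
    · simp
    · simp [pow_succ, mul_assoc]
  rw [hk, ← sum_range_sum_range_two_pow]
  refine norm_sum_le_of_le _ fun l _ => norm_sum_le_of_le _ fun m _ => ?_
  have h := pow_le_pow_left₀ (norm_nonneg _) (norm_blockSum_le hf (l + 1) m) 2
  rw [norm_smul, norm_inv, norm_pow, Real.norm_two, inv_mul_le_iff₀ (by positivity)]
  refine (hq1 _).trans (h.trans (le_of_eq ?_))
  ring

variable {X : Submodule ℂ A} {ψ : X →ₗ[ℝ] X →ₗ[ℝ] X}

theorem norm_sum_smul_le
    (hψ : ∀ (s : Finset (Σ _ : ℕ, ℕ)) (x y : (Σ _ : ℕ, ℕ) → X),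
      ‖∑ i ∈ s, ψ (x i) (y i)‖ ^ 2 ≤
        ‖∑ i ∈ s, (x i : A) * star (x i : A)‖ * ‖∑ i ∈ s, star (y i : A) * (y i : A)‖)
    (s : Finset ℕ) (t : ℕ → Finset ℕ) (c : ℕ → ℝ) (hc : ∀ l, 0 ≤ c l) (x y : ℕ → ℕ → X) :
    ‖∑ l ∈ s, ∑ m ∈ t l, c l • ψ (x l m) (y l m)‖ ^ 2 ≤
      ‖∑ l ∈ s, ∑ m ∈ t l, c l • ((x l m : A) * star (x l m : A))‖ *
        ‖∑ l ∈ s, ∑ m ∈ t l, c l • (star (y l m : A) * (y l m : A))‖ := by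
  have h := hψ (s.sigma t) (fun i => √(c i.1) • x i.1 i.2) (fun i => √(c i.1) • y i.1 i.2)
  simpa only [Finset.sum_sigma, map_smul, LinearMap.smul_apply, smul_smul,
    Real.mul_self_sqrt (hc _), Submodule.coe_smul_of_tower, star_smul, star_trivial,
    smul_mul_smul_comm] using h

variable [PartialOrder A] [StarOrderedRing A]

theorem norm_sum_haar_le {E : Type*} [NormedAddCommGroup E] [NormedSpace ℝ E] {q : E → A}
    (hq : ∀ a b, q (a + b) + q (a - b) = (2 : ℝ) • (q a + q b)) (hq0 : ∀ a, 0 ≤ q a)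
    (hq1 : ∀ a, ‖q a‖ ≤ ‖a‖ ^ 2) {f : ℕ → E} (hf : ∀ j, ‖f j‖ ≤ 1) (k : ℕ) :
    ‖∑ l ∈ Finset.range k, ∑ m ∈ Finset.range (2 ^ (k - 1 - l)),
      ((2 : ℝ) ^ (l + 1))⁻¹ • q (blockSum f l (2 * m) - blockSum f l (2 * m + 1))‖ ≤ 2 ^ k := by
  have h1 : ‖∑ j ∈ Finset.range (2 ^ k), q (f j)‖ ≤ 2 ^ k := by
    refine (norm_sum_le_of_le _ fun j _ =>
      (hq1 (f j)).trans (pow_le_one₀ (norm_nonneg _) (hf j))).trans (le_of_eq ?_)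
    simp
  refine (CStarAlgebra.norm_le_norm_of_nonneg_of_le ?_ ?_).trans h1
  · exact Finset.sum_nonneg fun l _ => Finset.sum_nonneg fun m _ =>
      smul_nonneg (by positivity) (hq0 _)
  · rw [sum_haar_eq q hq]
    exact sub_le_self _ (smul_nonneg (by positivity) (hq0 _))

theorem norm_leftSum_sub_leftSum_le
    (hψ : ∀ (s : Finset (Σ _ : ℕ, ℕ)) (x y : (Σ _ : ℕ, ℕ) → X),
      ‖∑ i ∈ s, ψ (x i) (y i)‖ ^ 2 ≤
        ‖∑ i ∈ s, (x i : A) * star (x i : A)‖ * ‖∑ i ∈ s, star (y i : A) * (y i : A)‖)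
    {e f : ℕ → X} (he : ∀ j, ‖e j‖ ≤ 1) (hf : ∀ j, ‖f j‖ ≤ 1) {ε : ℝ}
    (hfe : ∀ i j, i < j → ‖ψ (f i) (e j) - f i‖ ≤ ε)
    (hef : ∀ i j, i < j → ‖ψ (f j) (e i) - e i‖ ≤ ε) (k : ℕ) :
    ‖leftSum f k - leftSum e k‖ ≤ 2 * (2 ^ k * √k) + k * 2 ^ (k - 1) * (2 * ε) := by
  have hrow (a b : X) : ((a + b : X) : A) * star ((a + b : X) : A) +
      ((a - b : X) : A) * star ((a - b : X) : A) =
      (2 : ℝ) • ((a : A) * star (a : A) + (b : A) * star (b : A)) := by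
    simp only [Submodule.coe_add, Submodule.coe_sub, star_add, star_sub, two_smul]
    noncomm_ring
  have hcol (a b : X) : star ((a + b : X) : A) * ((a + b : X) : A) +
      star ((a - b : X) : A) * ((a - b : X) : A) =
      (2 : ℝ) • (star (a : A) * (a : A) + star (b : A) * (b : A)) := by
    simp only [Submodule.coe_add, Submodule.coe_sub, star_add, star_sub, two_smul]
    noncomm_ring
  have hrow1 (a : X) : ‖(a : A) * star (a : A)‖ ≤ ‖a‖ ^ 2 := by
    rw [CStarRing.norm_self_mul_star, sq, Submodule.coe_norm]
  have hcol1 (a : X) : ‖star (a : A) * (a : A)‖ ≤ ‖a‖ ^ 2 := by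
    rw [CStarRing.norm_star_mul_self, sq, Submodule.coe_norm]
  have hc (l : ℕ) : 0 ≤ ((2 : ℝ) ^ (l + 1))⁻¹ := by positivity
  have hsq : (2 : ℝ) ^ k * (k * 2 ^ k) = (2 ^ k * √k) ^ 2 := by
    rw [mul_pow, Real.sq_sqrt (Nat.cast_nonneg k)]
    ring
  have hP := norm_sum_smul_le hψ (Finset.range k) (fun l => Finset.range (2 ^ (k - 1 - l))) _ hc
    (fun l m => blockSum f l (2 * m) - blockSum f l (2 * m + 1))
    (fun l m => blockSum e l (2 * m) + blockSum e l (2 * m + 1))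
  have hQ := norm_sum_smul_le hψ (Finset.range k) (fun l => Finset.range (2 ^ (k - 1 - l))) _ hc
    (fun l m => blockSum f l (2 * m) + blockSum f l (2 * m + 1))
    (fun l m => blockSum e l (2 * m) - blockSum e l (2 * m + 1))
  have hP' := abs_le_of_sq_le_sq' (hsq ▸ hP.trans (mul_le_mul
    (norm_sum_haar_le hrow (fun a => mul_star_self_nonneg _) hrow1 hf k)
    (norm_sum_blockSum_le hcol1 he k) (norm_nonneg _) (by positivity))) (by positivity)
  have hQ' := abs_le_of_sq_le_sq' (hsq ▸ hQ.trans ((mul_le_mul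
    (norm_sum_blockSum_le hrow1 hf k)
    (norm_sum_haar_le hcol (fun a => star_mul_self_nonneg _) hcol1 he k)
    (norm_nonneg _) (by positivity)).trans_eq (mul_comm _ _))) (by positivity)
  have hD := norm_sub_le_of_le hP'.2 hQ'.2
  rw [← two_mul] at hD
  refine (norm_le_norm_add_norm_sub _ _).trans (add_le_add hD ?_)
  rw [leftSum, leftSum, ← sum_range_sum_range_two_pow, ← Finset.sum_sub_distrib,
    ← Finset.sum_sub_distrib, ← Finset.sum_sub_distrib]
  refine norm_sum_le_of_le _ fun l _ => ?_
  rw [← Finset.sum_sub_distrib, ← Finset.sum_sub_distrib, ← Finset.sum_sub_distrib]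
  refine norm_sum_le_of_le _ fun m _ => ?_
  have h1 := norm_bilin_blockSum_sub_le ψ hfe l (Nat.lt_succ_self (2 * m))
  have h2 := norm_bilin_blockSum_sub_le ψ.flip (u := e) (v := f) hef l
    (Nat.lt_succ_self (2 * m))
  have h3 := norm_sub_le_of_le h1 h2
  have h4 : (2 : ℝ) ^ l * (2 * ε) = ((2 : ℝ) ^ l)⁻¹ * (4 ^ l * ε + 4 ^ l * ε) := by
    rw [show (4 : ℝ) ^ l = 2 ^ l * 2 ^ l by rw [← mul_pow]; norm_num]
    field_simp
    ring
  have h5 : (0 : ℝ) < 2 ^ l := by positivity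
  rw [h4, ← inv_mul_le_iff₀ (by positivity), inv_inv]
  refine le_trans (le_of_eq ?_) h3
  rw [← Real.norm_of_nonneg h5.le, ← norm_smul]
  congr 1
  simp only [map_add, map_sub, LinearMap.add_apply, LinearMap.sub_apply, LinearMap.flip_apply,
    smul_sub, smul_add, smul_smul, pow_succ, mul_inv, Real.norm_of_nonneg h5.le]
  match_scalars <;> field_simp <;> norm_num

theorem eventually_forall_norm_sub_le {E ι : Type*} [SeminormedAddCommGroup E] {l : Filter ι}
    {T : E → ι → E} (hT : ∀ x, Filter.Tendsto (T x) l (nhds x)) {ε : ℝ} (hε : 0 < ε)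
    (s : Finset E) : ∀ᶠ i in l, ∀ x ∈ s, ‖T x i - x‖ ≤ ε :=
  (Filter.eventually_all_finset s).2 fun x _ =>
    (tendsto_iff_norm_sub_tendsto_zero.1 (hT x)).eventually_le_const hε

theorem exists_twoSided_approx (ψ : X →ₗ[ℝ] X →ₗ[ℝ] X)
    (hψ : ∀ (s : Finset (Σ _ : ℕ, ℕ)) (x y : (Σ _ : ℕ, ℕ) → X),
      ‖∑ i ∈ s, ψ (x i) (y i)‖ ^ 2 ≤
        ‖∑ i ∈ s, (x i : A) * star (x i : A)‖ * ‖∑ i ∈ s, star (y i : A) * (y i : A)‖)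
    {ι κ : Type*} {l : Filter ι} {l' : Filter κ} [l.NeBot] [l'.NeBot] {e : ι → X} {f : κ → X}
    (he1 : ∀ α, ‖e α‖ ≤ 1) (hf1 : ∀ β, ‖f β‖ ≤ 1)
    (he : ∀ x, Filter.Tendsto (fun α => ψ x (e α)) l (nhds x))
    (hf : ∀ x, Filter.Tendsto (fun β => ψ (f β) x) l' (nhds x))
    (F : Finset X) {δ : ℝ} (hδ : 0 < δ) :
    ∃ g : X, ‖g‖ ≤ 1 ∧ ∀ x ∈ F, ‖ψ x g - x‖ ≤ δ ∧ ‖ψ g x - x‖ ≤ δ := by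
  classical
  have hψ1 (x y : X) : ‖ψ x y‖ ≤ ‖x‖ * ‖y‖ := by
    have h := hψ {⟨0, 0⟩} (fun _ => x) (fun _ => y)
    simp only [Finset.sum_singleton, CStarRing.norm_self_mul_star,
      CStarRing.norm_star_mul_self] at h
    refine le_of_sq_le_sq (h.trans_eq ?_) (by positivity)
    rw [Submodule.coe_norm, Submodule.coe_norm]
    ring
  obtain ⟨C, hC0, hC⟩ : ∃ C : ℝ, 0 < C ∧ ∀ x ∈ F, ‖x‖ ≤ C := by
    obtain ⟨C, hC⟩ := (F.finite_toSet.image norm).bddAbove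
    exact ⟨max C 1, by positivity, fun x hx =>
      (hC (Set.mem_image_of_mem _ hx)).trans (le_max_left _ _)⟩
  obtain ⟨ε, hε, hεC⟩ : ∃ ε : ℝ, 0 < ε ∧ 2 * ε * C + ε ≤ δ / 2 :=
    ⟨δ / (2 * (2 * C + 1)), by positivity, le_of_eq (by field_simp)⟩
  obtain ⟨k, hk, hkC⟩ : ∃ k : ℕ, k ≠ 0 ∧ 4 / √k * C ≤ δ / 2 := by
    obtain ⟨k, hk⟩ := exists_nat_gt ((8 * C / δ) ^ 2)
    have h0 : 8 * C / δ < √k := Real.lt_sqrt_of_sq_lt hk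
    have h1 : 0 < √k := lt_trans (by positivity) h0
    refine ⟨k, fun h => by simp [h] at h1, ?_⟩
    rw [div_lt_iff₀ hδ] at h0
    rw [div_mul_eq_mul_div, div_le_iff₀ h1]
    linarith
  obtain ⟨p, hp, hpr⟩ := exists_seq_of_forall_finset_exists
    (fun p : X × X => (‖p.1‖ ≤ 1 ∧ ‖p.2‖ ≤ 1) ∧
      (∀ x ∈ F, ‖ψ x p.1 - x‖ ≤ ε) ∧ ∀ x ∈ F, ‖ψ p.2 x - x‖ ≤ ε)
    (fun p p' => ‖ψ p.2 p'.1 - p.2‖ ≤ ε ∧ ‖ψ p'.2 p.1 - p.1‖ ≤ ε) (by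
      intro s _
      obtain ⟨α, hα⟩ := (eventually_forall_norm_sub_le he hε (F ∪ s.image Prod.snd)).exists
      obtain ⟨β, hβ⟩ := (eventually_forall_norm_sub_le hf hε (F ∪ s.image Prod.fst)).exists
      refine ⟨(e α, f β), ⟨⟨he1 α, hf1 β⟩, fun x hx => hα x (Finset.mem_union_left _ hx),
        fun x hx => hβ x (Finset.mem_union_left _ hx)⟩, fun p hp => ⟨hα _ ?_, hβ _ ?_⟩⟩
      all_goals exact Finset.mem_union_right _ (Finset.mem_image_of_mem _ hp))
  set c : ℝ := k * 2 ^ (k - 1) with hc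
  have hc0 : 0 < c := by positivity
  set g := c⁻¹ • leftSum (fun n => (p n).1) k with hg
  set g' := c⁻¹ • leftSum (fun n => (p n).2) k with hg'
  have hgg' : ‖g - g'‖ ≤ 4 / √k + 2 * ε := by
    have h := norm_leftSum_sub_leftSum_le hψ (e := fun n => (p n).1) (f := fun n => (p n).2)
      (fun j => (hp j).1.1) (fun j => (hp j).1.2) (fun i j h => (hpr i j h).1)
      (fun i j h => (hpr i j h).2) k
    have h2 : (2 : ℝ) ^ k = 2 ^ (k - 1) * 2 := by
      rw [← pow_succ, Nat.sub_add_cancel (Nat.pos_of_ne_zero hk)]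
    have hs : √(k : ℝ) * √k = k := Real.mul_self_sqrt (Nat.cast_nonneg k)
    have hs0 : 0 < √(k : ℝ) := by positivity
    rw [norm_sub_rev, hg, hg', ← smul_sub, norm_smul, norm_inv, Real.norm_of_nonneg hc0.le,
      inv_mul_le_iff₀ hc0]
    refine h.trans (le_of_eq ?_)
    rw [hc, h2, mul_add]
    congr 1
    nth_rewrite 2 [← hs]
    field_simp
    ring
  refine ⟨g, ?_, fun x hx => ⟨?_, ?_⟩⟩
  · have h := norm_map_average_sub_le (LinearMap.id : X →ₗ[ℝ] X) (x := 0) (ε := 1)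
      (f := fun n => (p n).1) (fun j => by simpa using (hp j).1.1) hk
    rwa [sub_zero] at h
  · have h := norm_map_average_sub_le (ψ x) (f := fun n => (p n).1)
      (fun j => (hp j).2.1 x hx) hk
    exact h.trans (by nlinarith)
  · have h := norm_map_average_sub_le (ψ.flip x) (f := fun n => (p n).2)
      (fun j => (hp j).2.2 x hx) hk
    have h1 : ψ g x - x = ψ (g - g') x + (ψ.flip x g' - x) := by
      rw [map_sub, LinearMap.sub_apply, LinearMap.flip_apply]
      abel
    have h2 : ‖ψ (g - g') x‖ ≤ (4 / √k + 2 * ε) * C :=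
      (hψ1 _ _).trans (mul_le_mul hgg' (hC x hx) (norm_nonneg _) (by positivity))
    rw [h1]
    refine (norm_add_le_of_le h2 h).trans ?_
    linarith

end Haagerup

universe u v w

theorem isDirected_uLift {α : Type*} [Preorder α] [IsDirected α (· ≤ ·)] :
    IsDirected (ULift α) (· ≤ ·) :=
  ⟨fun a b => let ⟨c, ha, hb⟩ := exists_ge_ge a.down b.down; ⟨⟨c⟩, ha, hb⟩⟩

theorem tendsto_uliftDown_finset_prod_nat {E : Type*} [SeminormedAddCommGroup E]
    {T : E → Finset E × ℕ → E}
    (hT : ∀ γ, ∀ x ∈ γ.1, ‖T x γ - x‖ ≤ 1 / ((γ.2 : ℝ) + 1)) (x : E) :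
    Filter.Tendsto (fun γ : ULift.{w} (Finset E × ℕ) => T x γ.down) Filter.atTop (nhds x) := by
  classical
  have : IsDirected (ULift.{w} (Finset E × ℕ)) (· ≤ ·) := isDirected_uLift
  refine Metric.tendsto_atTop.2 fun δ hδ => ?_
  obtain ⟨n, hn⟩ := exists_nat_one_div_lt hδ
  refine ⟨⟨({x}, n)⟩, fun γ hγ => ?_⟩
  obtain ⟨h1, h2⟩ : {x} ≤ γ.down.1 ∧ n ≤ γ.down.2 := hγ
  rw [dist_eq_norm]
  exact (hT _ x (h1 (Finset.mem_singleton_self x))).trans_lt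
    ((Nat.one_div_le_one_div h2).trans_lt hn)

/-- Let `X` be a nonzero closed subspace of `B(H)` and `φ : X × X → X` a bilinear map
which is completely contractive in the Christensen–Sinclair sense.  If there are nets
`(e_α)`, `(f_β)` in the unit ball of `X` with `φ(x, e_α) → x` and `φ(f_β, x) → x` in
norm for every `x ∈ X`, then `(X, φ)` has a two-sided contractive approximate
identity: a single net `(g_γ)` in the unit ball of `X` with `φ(x, g_γ) → x` and
`φ(g_γ, x) → x` in norm for every `x ∈ X`. -/
theorem stmt5 {H : Type u} [NormedAddCommGroup H] [InnerProductSpace ℂ H]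
    [CompleteSpace H]
    (X : Submodule ℂ (H →L[ℂ] H)) (hXc : IsClosed (X : Set (H →L[ℂ] H))) (hX0 : X ≠ ⊥)
    (φ : X →ₗ[ℂ] X →ₗ[ℂ] X)
    (hφcc : ∀ (n : ℕ) (a b : Matrix (Fin n) (Fin n) X),
      cstarMatrixNorm (Matrix.of fun i j => ((∑ k, φ (a i k) (b k j) : X) : H →L[ℂ] H)) ≤
        cstarMatrixNorm (a.map (fun x => (x : H →L[ℂ] H))) *
          cstarMatrixNorm (b.map (fun x => (x : H →L[ℂ] H))))
    {ι : Type v} {κ : Type w} [Preorder ι] [IsDirected ι (· ≤ ·)] [Nonempty ι]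
    [Preorder κ] [IsDirected κ (· ≤ ·)] [Nonempty κ]
    (e : ι → X) (f : κ → X)
    (he1 : ∀ α, ‖(e α : H →L[ℂ] H)‖ ≤ 1) (hf1 : ∀ β, ‖(f β : H →L[ℂ] H)‖ ≤ 1)
    (he : ∀ x : X, Filter.Tendsto (fun α => ((φ x (e α) : X) : H →L[ℂ] H))
      Filter.atTop (nhds (x : H →L[ℂ] H)))
    (hf : ∀ x : X, Filter.Tendsto (fun β => ((φ (f β) x : X) : H →L[ℂ] H))
      Filter.atTop (nhds (x : H →L[ℂ] H))) :
    ∃ (ι' : Type (max u v w)) (p : Preorder ι'),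
      letI := p
      IsDirected ι' (· ≤ ·) ∧ Nonempty ι' ∧
      ∃ g : ι' → X,
        (∀ γ, ‖(g γ : H →L[ℂ] H)‖ ≤ 1) ∧
        (∀ x : X, Filter.Tendsto (fun γ => ((φ x (g γ) : X) : H →L[ℂ] H))
          Filter.atTop (nhds (x : H →L[ℂ] H))) ∧
        (∀ x : X, Filter.Tendsto (fun γ => ((φ (g γ) x : X) : H →L[ℂ] H))
          Filter.atTop (nhds (x : H →L[ℂ] H))) := by
  classical
  obtain ⟨G, hG1, hGr, hGl⟩ :
      ∃ G : Finset X × ℕ → X, (∀ γ, ‖G γ‖ ≤ 1) ∧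
        (∀ γ, ∀ x ∈ γ.1, ‖φ x (G γ) - x‖ ≤ 1 / (γ.2 + 1)) ∧
        (∀ γ, ∀ x ∈ γ.1, ‖φ (G γ) x - x‖ ≤ 1 / (γ.2 + 1)) := by
    have h (γ : Finset X × ℕ) := exists_twoSided_approx (φ.restrictScalars₁₂ ℝ ℝ)
      (fun s x y => sq_norm_sum_le_of_completelyContractive φ hφcc s x y)
      he1 hf1 (fun x => tendsto_subtype_rng.2 (he x)) (fun x => tendsto_subtype_rng.2 (hf x))
      γ.1 (Nat.one_div_pos_of_nat (α := ℝ) (n := γ.2))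
    choose G hG using h
    exact ⟨G, fun γ => (hG γ).1, fun γ x hx => ((hG γ).2 x hx).1,
      fun γ x hx => ((hG γ).2 x hx).2⟩
  have hlim (T : X → Finset X × ℕ → X)
      (hT : ∀ γ, ∀ x ∈ γ.1, ‖T x γ - x‖ ≤ 1 / ((γ.2 : ℝ) + 1)) (x : X) :
      Filter.Tendsto (fun γ : ULift.{max u v w} (Finset X × ℕ) => (T x γ.down : H →L[ℂ] H))
        Filter.atTop (nhds (x : H →L[ℂ] H)) :=
    tendsto_subtype_rng.1 (tendsto_uliftDown_finset_prod_nat hT x)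
  exact ⟨ULift.{max u v w} (Finset X × ℕ), inferInstance, isDirected_uLift, inferInstance,
    fun γ => G γ.down, fun γ => hG1 _, hlim (fun x γ => φ x (G γ)) hGr,
    hlim (fun x γ => φ (G γ) x) hGl⟩
end

section
/- Let H be a complex Hilbert space and A a C*-subalgebra of B(H) acting nondegenerately, i.e., the linear span of {a ξ : a ∈ A, ξ ∈ H} is dense in H. Let φ : A × A → A be a quasi-centralizer, i.e., a bounded bilinear map satisfying φ(a·b, c) = a·φ(b, c) and φ(a, b·c) = φ(a, b)·c for all a, b, c ∈ A. Then there exists a unique T ∈ B(H) such that φ(a, b) = a·T·b for all a, b ∈ A; moreover, ‖T‖ = ‖φ‖, where ‖φ‖ := sup{‖φ(a, b)‖ : a, b ∈ A, ‖a‖ ≤ 1, ‖b‖ ≤ 1}. -/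
open Filter Topology in
/-- Bounded sets of operators are relatively compact in the weak operator topology. -/
theorem exists_tendsto_inner_of_eventually_norm_le {ι H : Type*} [NormedAddCommGroup H]
    [InnerProductSpace ℂ H] [CompleteSpace H] (U : Ultrafilter ι) (S : ι → H →L[ℂ] H) {C : ℝ}
    (hS : ∀ᶠ i in U, ‖S i‖ ≤ C) :
    ∃ T : H →L[ℂ] H, ‖T‖ ≤ C ∧
      ∀ x y, Tendsto (fun i ↦ inner ℂ (S i x) y) U (𝓝 (inner ℂ (T x) y)) := by
  have hC : 0 ≤ C := by
    obtain ⟨i, hi⟩ := hS.exists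
    exact (norm_nonneg _).trans hi
  have hbound (x y : H) : ∀ᶠ i in U, ‖inner ℂ (S i x) y‖ ≤ C * ‖x‖ * ‖y‖ := by
    filter_upwards [hS] with i hi
    exact (norm_inner_le_norm _ _).trans <| by gcongr; exact (S i).le_of_opNorm_le hi x
  have hlim (x y : H) : ∃ z, Tendsto (fun i ↦ inner ℂ (S i x) y) U (𝓝 z) := by
    have hmem : ∀ᶠ i in U, inner ℂ (S i x) y ∈ Metric.closedBall (0 : ℂ) (C * ‖x‖ * ‖y‖) := by
      simpa using hbound x y
    obtain ⟨z, -, hz⟩ := (isCompact_closedBall (0 : ℂ) (C * ‖x‖ * ‖y‖)).ultrafilter_le_nhds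
      (U.map fun i ↦ inner ℂ (S i x) y) (le_principal_iff.mpr hmem)
    exact ⟨z, hz⟩
  choose L hL using hlim
  have hLbound (x y : H) : ‖L x y‖ ≤ C * ‖x‖ * ‖y‖ := le_of_tendsto (hL x y).norm (hbound x y)
  let B : H →L⋆[ℂ] H →L[ℂ] ℂ := LinearMap.mkContinuous₂
    (LinearMap.mk₂'ₛₗ (starRingEnd ℂ) (RingHom.id ℂ) L
      (fun x x' y ↦ tendsto_nhds_unique (hL _ _) <| by
        simpa [inner_add_left] using (hL x y).add (hL x' y))
      (fun c x y ↦ tendsto_nhds_unique (hL _ _) <| by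
        simpa [inner_smul_left, mul_comm] using (hL x y).const_mul (starRingEnd ℂ c))
      (fun x y y' ↦ tendsto_nhds_unique (hL _ _) <| by
        simpa [inner_add_right] using (hL x y).add (hL x y'))
      (fun c x y ↦ tendsto_nhds_unique (hL _ _) <| by
        simpa [inner_smul_right] using (hL x y).const_mul c)) C hLbound
  have hB (x y : H) : inner ℂ (InnerProductSpace.continuousLinearMapOfBilin B x) y = L x y :=
    InnerProductSpace.continuousLinearMapOfBilin_apply B x y
  refine ⟨InnerProductSpace.continuousLinearMapOfBilin B,
    ContinuousLinearMap.opNorm_le_bound _ hC fun x ↦ ?_, fun x y ↦ hB x y ▸ hL x y⟩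
  set v := InnerProductSpace.continuousLinearMapOfBilin B x with hv
  rcases (norm_nonneg v).eq_or_lt with h | h
  · rw [← h]; positivity
  · refine le_of_mul_le_mul_right ?_ h
    rw [← inner_self_eq_norm_mul_norm (𝕜 := ℂ), hB]
    exact (RCLike.re_le_norm _).trans (hLbound x v)

open Filter Topology in
/-- A closed *-subalgebra of `B(H)` has a contractive approximate unit, indexed by an
ultrafilter. -/
theorem exists_ultrafilter_approximateUnit {H : Type*} [NormedAddCommGroup H]
    [InnerProductSpace ℂ H] [CompleteSpace H]
    (A : NonUnitalStarSubalgebra ℂ (H →L[ℂ] H)) (hAc : IsClosed (A : Set (H →L[ℂ] H))) :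
    ∃ U : Ultrafilter A, (U : Filter A).IsApproximateUnit ∧
      ∀ᶠ e : A in U, ‖(e : H →L[ℂ] H)‖ ≤ 1 := by
  let _ : NonUnitalCStarAlgebra A :=
    NonUnitalStarSubalgebra.nonUnitalCStarAlgebra A (h_closed := hAc)
  let _ := CStarAlgebra.spectralOrder A
  have _ := CStarAlgebra.spectralOrderedRing A
  have hu := CStarAlgebra.increasingApproximateUnit A
  have hle := Ultrafilter.of_le (CStarAlgebra.approximateUnit A)
  exact ⟨Ultrafilter.of (CStarAlgebra.approximateUnit A),
    { tendsto_mul_left a := (hu.tendsto_mul_left a).mono_left hle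
      tendsto_mul_right a := (hu.tendsto_mul_right a).mono_left hle },
    hu.eventually_norm.filter_mono hle⟩

open Filter Topology in
/-- A quasi-centralizer bounded by `C` on the unit ball is implemented by an operator of norm at
most `C`. -/
theorem exists_quasiMultiplier_norm_le {H : Type*} [NormedAddCommGroup H]
    [InnerProductSpace ℂ H] [CompleteSpace H]
    (A : NonUnitalStarSubalgebra ℂ (H →L[ℂ] H)) (hAc : IsClosed (A : Set (H →L[ℂ] H)))
    (φ : A →ₗ[ℂ] A →ₗ[ℂ] A)
    (hbdd : ∃ C : ℝ, ∀ a b : A,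
      ‖((φ a b : A) : H →L[ℂ] H)‖ ≤ C * ‖(a : H →L[ℂ] H)‖ * ‖(b : H →L[ℂ] H)‖)
    (hleft : ∀ a b c : A, φ (a * b) c = a * φ b c)
    (hright : ∀ a b c : A, φ a (b * c) = φ a b * c) {C : ℝ}
    (hC : ∀ a b : A, ‖(a : H →L[ℂ] H)‖ ≤ 1 → ‖(b : H →L[ℂ] H)‖ ≤ 1 →
      ‖((φ a b : A) : H →L[ℂ] H)‖ ≤ C) :
    ∃ T : H →L[ℂ] H, ‖T‖ ≤ C ∧ ∀ a b : A,
      ((φ a b : A) : H →L[ℂ] H) = (a : H →L[ℂ] H) * T * (b : H →L[ℂ] H) := by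
  obtain ⟨K, hK⟩ := hbdd
  obtain ⟨U, hU, hU₁⟩ := exists_ultrafilter_approximateUnit A hAc
  obtain ⟨T, hT, hlim⟩ := exists_tendsto_inner_of_eventually_norm_le U
    (fun e ↦ ((φ e e : A) : H →L[ℂ] H)) (C := C)
    (hU₁.mono fun e he ↦ hC e e he he)
  have hcont : Continuous fun p : A × A ↦ φ p.1 p.2 :=
    (LinearMap.mkContinuous₂ φ K hK).continuous₂
  refine ⟨T, hT, fun a b ↦ ContinuousLinearMap.ext fun x ↦ ext_inner_right ℂ fun y ↦ ?_⟩
  have hae : Tendsto (fun e : A ↦ (a * e, e * b)) U (𝓝 (a, b)) :=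
    (hU.tendsto_mul_left a).prodMk_nhds (hU.tendsto_mul_right b)
  have hinner : Continuous fun c : A ↦ inner ℂ ((c : H →L[ℂ] H) x) y := by fun_prop
  have h₁ := ((hinner.comp hcont).tendsto (a, b)).comp hae
  simp only [Function.comp_def] at h₁
  refine tendsto_nhds_unique h₁ ?_
  have h₂ := hlim (b.1 x) (ContinuousLinearMap.adjoint a.1 y)
  simp only [ContinuousLinearMap.adjoint_inner_right] at h₂
  have heq (e : A) : (φ (a * e) (e * b) : A).1 = a.1 * (φ e e).1 * b.1 := by
    rw [hleft, hright, ← mul_assoc]; rfl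
  simpa [heq] using h₂

/-- Two operators with the same compressions by a nondegenerate *-algebra agree. -/
theorem eq_of_forall_mul_mul_eq {H : Type*} [NormedAddCommGroup H]
    [InnerProductSpace ℂ H] [CompleteSpace H] (A : NonUnitalStarSubalgebra ℂ (H →L[ℂ] H))
    (hnd : Dense ((Submodule.span ℂ {ξ : H | ∃ a ∈ A, ∃ η : H, a η = ξ} : Submodule ℂ H) : Set H))
    {S T : H →L[ℂ] H} (h : ∀ a b : A, a.1 * S * b.1 = a.1 * T * b.1) : S = T := by
  refine ContinuousLinearMap.ext_on hnd ?_
  rintro _ ⟨b, hb, x, rfl⟩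
  refine ext_inner_right ℂ fun y ↦ ?_
  suffices innerSL ℂ (S (b x)) = innerSL ℂ (T (b x)) from DFunLike.congr_fun this y
  refine ContinuousLinearMap.ext_on hnd ?_
  rintro _ ⟨a, ha, y, rfl⟩
  have := congrArg (fun R : H →L[ℂ] H ↦ inner ℂ (R x) y) (h ⟨star a, star_mem ha⟩ ⟨b, hb⟩)
  simpa [ContinuousLinearMap.star_eq_adjoint, ContinuousLinearMap.adjoint_inner_left] using this

/-- Let `A` be a C*-subalgebra of `B(H)` acting nondegenerately, and let
`φ : A × A → A` be a quasi-centralizer: a bounded bilinear map with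
`φ(a·b, c) = a·φ(b, c)` and `φ(a, b·c) = φ(a, b)·c`.  Then there is a unique
`T ∈ B(H)` with `φ(a, b) = a·T·b` for all `a, b ∈ A`, and moreover
`‖T‖ = ‖φ‖ := sup {‖φ(a,b)‖ : ‖a‖ ≤ 1, ‖b‖ ≤ 1}`. -/
theorem stmt7 {H : Type*} [NormedAddCommGroup H] [InnerProductSpace ℂ H]
    [CompleteSpace H]
    (A : NonUnitalStarSubalgebra ℂ (H →L[ℂ] H)) (hAc : IsClosed (A : Set (H →L[ℂ] H)))
    (hnd : Dense ((Submodule.span ℂ {ξ : H | ∃ a ∈ A, ∃ η : H, a η = ξ} : Submodule ℂ H) : Set H))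
    (φ : A →ₗ[ℂ] A →ₗ[ℂ] A)
    (hbdd : ∃ C : ℝ, ∀ a b : A,
      ‖((φ a b : A) : H →L[ℂ] H)‖ ≤ C * ‖(a : H →L[ℂ] H)‖ * ‖(b : H →L[ℂ] H)‖)
    (hleft : ∀ a b c : A, φ (a * b) c = a * φ b c)
    (hright : ∀ a b c : A, φ a (b * c) = φ a b * c) :
    (∃! T : H →L[ℂ] H, ∀ a b : A,
        ((φ a b : A) : H →L[ℂ] H) = (a : H →L[ℂ] H) * T * (b : H →L[ℂ] H)) ∧
    (∀ T : H →L[ℂ] H,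
      (∀ a b : A, ((φ a b : A) : H →L[ℂ] H) = (a : H →L[ℂ] H) * T * (b : H →L[ℂ] H)) →
      ‖T‖ = sSup {r : ℝ | ∃ a b : A, ‖(a : H →L[ℂ] H)‖ ≤ 1 ∧ ‖(b : H →L[ℂ] H)‖ ≤ 1 ∧
        r = ‖((φ a b : A) : H →L[ℂ] H)‖}) := by
  have huniq {S T : H →L[ℂ] H}
      (hS : ∀ a b : A, ((φ a b : A) : H →L[ℂ] H) = (a : H →L[ℂ] H) * S * (b : H →L[ℂ] H))
      (hT : ∀ a b : A, ((φ a b : A) : H →L[ℂ] H) = (a : H →L[ℂ] H) * T * (b : H →L[ℂ] H)) :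
      S = T :=
    eq_of_forall_mul_mul_eq A hnd fun a b ↦ (hS a b).symm.trans (hT a b)
  set R := {r : ℝ | ∃ a b : A, ‖(a : H →L[ℂ] H)‖ ≤ 1 ∧ ‖(b : H →L[ℂ] H)‖ ≤ 1 ∧
    r = ‖((φ a b : A) : H →L[ℂ] H)‖}
  have hle {T : H →L[ℂ] H}
      (hT : ∀ a b : A, ((φ a b : A) : H →L[ℂ] H) = (a : H →L[ℂ] H) * T * (b : H →L[ℂ] H)) :
      ‖T‖ ∈ upperBounds R := by
    rintro _ ⟨a, b, ha, hb, rfl⟩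
    calc ‖((φ a b : A) : H →L[ℂ] H)‖ ≤ ‖a.1‖ * ‖T‖ * ‖b.1‖ := hT a b ▸ norm_mul₃_le
      _ ≤ 1 * ‖T‖ * 1 := by gcongr
      _ = ‖T‖ := by ring
  have hR : BddAbove R := by
    obtain ⟨K, hK⟩ := hbdd
    refine ⟨|K|, ?_⟩
    rintro _ ⟨a, b, ha, hb, rfl⟩
    calc ‖((φ a b : A) : H →L[ℂ] H)‖ ≤ K * ‖a.1‖ * ‖b.1‖ := hK a b
      _ ≤ |K| * 1 * 1 := by gcongr; exact le_abs_self K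
      _ = |K| := by ring
  obtain ⟨T, hTR, hT⟩ := exists_quasiMultiplier_norm_le A hAc φ hbdd hleft hright (C := sSup R)
    fun a b ha hb ↦ le_csSup hR ⟨a, b, ha, hb, rfl⟩
  refine ⟨⟨T, hT, fun S hS ↦ huniq hS hT⟩, fun S hS ↦ huniq hT hS ▸ hTR.antisymm ?_⟩
  exact csSup_le ⟨_, 0, 0, by simp, by simp, rfl⟩ (hle hT)
end

section
/- Let H be a complex Hilbert space and A a C*-subalgebra of B(H) acting nondegenerately, i.e., the linear span of {a ξ : a ∈ A, ξ ∈ H} is dense in H. Let QM := {T ∈ B(H) : a·T·b ∈ A for all a, b ∈ A} and let QC be the set of quasi-centralizers of A, i.e., bounded bilinear maps φ : A × A → A satisfying φ(a·b, c) = a·φ(b, c) and φ(a, b·c) = φ(a, b)·c for all a, b, c ∈ A. Then the map Θ : QM → QC given by Θ(T)(a, b) = a·T·b is a well-defined linear bijection, and it is norm-preserving: ‖Θ(T)‖ = ‖T‖ for every T ∈ QM, where ‖Θ(T)‖ := sup{‖a·T·b‖ : a, b ∈ A, ‖a‖ ≤ 1, ‖b‖ ≤ 1}. -/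
/-- A quasi-centralizer of a C*-subalgebra `A ⊆ B(H)`: a bounded bilinear map
`φ : A × A → A` with `φ(a·b, c) = a·φ(b, c)` and `φ(a, b·c) = φ(a, b)·c`. -/
def IsQuasiCentralizer {H : Type*} [NormedAddCommGroup H] [InnerProductSpace ℂ H]
    [CompleteSpace H] (A : NonUnitalStarSubalgebra ℂ (H →L[ℂ] H))
    (φ : A → A → A) : Prop :=
  (∀ a b c : A, φ (a + b) c = φ a c + φ b c) ∧
  (∀ (s : ℂ) (a b : A), φ (s • a) b = s • φ a b) ∧
  (∀ a b c : A, φ a (b + c) = φ a b + φ a c) ∧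
  (∀ (s : ℂ) (a b : A), φ a (s • b) = s • φ a b) ∧
  (∃ C : ℝ, ∀ a b : A,
    ‖((φ a b : A) : H →L[ℂ] H)‖ ≤ C * ‖(a : H →L[ℂ] H)‖ * ‖(b : H →L[ℂ] H)‖) ∧
  (∀ a b c : A, φ (a * b) c = a * φ b c) ∧
  (∀ a b c : A, φ a (b * c) = φ a b * c)

section

open Filter Topology

/-- A bounded family of operators has a weak operator limit along every ultrafilter. -/
theorem exists_tendsto_inner_of_ultrafilter {ι H : Type*} [NormedAddCommGroup H]
    [InnerProductSpace ℂ H] [CompleteSpace H] (u : Ultrafilter ι) (f : ι → H →L[ℂ] H) (C : ℝ)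
    (hf : ∀ᶠ i in (u : Filter ι), ‖f i‖ ≤ C) :
    ∃ T : H →L[ℂ] H, ∀ x y : H,
      Tendsto (fun i => inner ℂ (f i x) y) (u : Filter ι) (𝓝 (inner ℂ (T x) y)) := by
  have hbound (x y : H) : ∀ᶠ i in (u : Filter ι), ‖inner ℂ (f i x) y‖ ≤ C * ‖x‖ * ‖y‖ := by
    filter_upwards [hf] with i hi
    calc ‖inner ℂ (f i x) y‖ ≤ ‖f i x‖ * ‖y‖ := norm_inner_le_norm _ _
      _ ≤ C * ‖x‖ * ‖y‖ := by
        gcongr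
        exact (f i).le_of_opNorm_le hi x
  have hlim (x y : H) : ∃ z : ℂ, Tendsto (fun i => inner ℂ (f i x) y) (u : Filter ι) (𝓝 z) := by
    have hK : IsCompact (Metric.closedBall (0 : ℂ) (C * ‖x‖ * ‖y‖)) := isCompact_closedBall _ _
    obtain ⟨z, -, hz⟩ := hK.ultrafilter_le_nhds (u.map fun i => inner ℂ (f i x) y) (by
      rw [le_principal_iff]
      exact (hbound x y).mono fun i hi => mem_closedBall_zero_iff.2 hi)
    exact ⟨z, hz⟩
  choose g hg using hlim
  let B : H →L⋆[ℂ] H →L[ℂ] ℂ := LinearMap.mkContinuous₂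
    (LinearMap.mk₂'ₛₗ (starRingEnd ℂ) (RingHom.id ℂ) g
      (fun x x' y => tendsto_nhds_unique (hg _ _)
        (by simpa [inner_add_left] using (hg x y).add (hg x' y)))
      (fun c x y => tendsto_nhds_unique (hg _ _)
        (by simpa [inner_smul_left, mul_comm] using (hg x y).const_mul (starRingEnd ℂ c)))
      (fun x y y' => tendsto_nhds_unique (hg _ _)
        (by simpa [inner_add_right] using (hg x y).add (hg x y')))
      (fun c x y => tendsto_nhds_unique (hg _ _)
        (by simpa [inner_smul_right] using (hg x y).const_mul c)))
    C (fun x y => le_of_tendsto (hg x y).norm (hbound x y))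
  refine ⟨InnerProductSpace.continuousLinearMapOfBilin B, fun x y => ?_⟩
  rw [InnerProductSpace.continuousLinearMapOfBilin_apply]
  exact hg x y

/-- A closed star subalgebra of `B(H)` acting nondegenerately has a contractive two-sided
approximate unit which converges strongly to the identity. -/
theorem exists_approximateUnit_tendsto {H : Type*} [NormedAddCommGroup H]
    [InnerProductSpace ℂ H] [CompleteSpace H]
    (A : NonUnitalStarSubalgebra ℂ (H →L[ℂ] H)) (hAc : IsClosed (A : Set (H →L[ℂ] H)))
    (hnd : Dense ((Submodule.span ℂ {ξ : H | ∃ a ∈ A, ∃ η : H, a η = ξ} :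
      Submodule ℂ H) : Set H)) :
    ∃ l : Filter A, l.NeBot ∧ (∀ᶠ e : A in l, ‖(e : H →L[ℂ] H)‖ ≤ 1) ∧
      (∀ a : A, Tendsto (fun e => e * a) l (𝓝 a)) ∧
      (∀ a : A, Tendsto (fun e => a * e) l (𝓝 a)) ∧
      ∀ x : H, Tendsto (fun e : A => (e : H →L[ℂ] H) x) l (𝓝 x) := by
  have : IsClosed (A : Set (H →L[ℂ] H)) := hAc
  let : PartialOrder A := CStarAlgebra.spectralOrder A
  have : StarOrderedRing A := CStarAlgebra.spectralOrderedRing A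
  have hl := CStarAlgebra.increasingApproximateUnit A
  have h1 : ∀ᶠ e : A in CStarAlgebra.approximateUnit A, ‖(e : H →L[ℂ] H)‖ ≤ 1 := hl.eventually_norm
  refine ⟨CStarAlgebra.approximateUnit A, inferInstance, h1, hl.tendsto_mul_right,
    hl.tendsto_mul_left, fun x => ?_⟩
  have hspan : ∀ y ∈ Submodule.span ℂ {ξ : H | ∃ a ∈ A, ∃ η : H, a η = ξ},
      Tendsto (fun e : A => (e : H →L[ℂ] H) y) (CStarAlgebra.approximateUnit A) (𝓝 y) := by
    intro y hy
    induction hy using Submodule.span_induction with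
    | mem y hy =>
      obtain ⟨a, ha, η, rfl⟩ := hy
      have h := hl.tendsto_mul_right ⟨a, ha⟩
      have hc : Continuous fun b : A => (b : H →L[ℂ] H) η := by fun_prop
      exact (hc.tendsto _).comp h
    | zero => simp
    | add y z _ _ hy hz => simpa using hy.add hz
    | smul c y _ hy => simpa using hy.const_smul c
  rw [Metric.tendsto_nhds]
  intro ε hε
  obtain ⟨y, hy, hxy⟩ := hnd.exists_dist_lt x (show 0 < ε / 3 by positivity)
  filter_upwards [h1, Metric.tendsto_nhds.1 (hspan y hy) (ε / 3) (by positivity)] with e he hey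
  have hex : dist ((e : H →L[ℂ] H) x) ((e : H →L[ℂ] H) y) ≤ dist x y := by
    rw [dist_eq_norm, dist_eq_norm, ← map_sub]
    simpa using (e : H →L[ℂ] H).le_of_opNorm_le he (x - y)
  have := dist_triangle4 ((e : H →L[ℂ] H) x) ((e : H →L[ℂ] H) y) y x
  rw [dist_comm y x] at this
  linarith

/-- Compressing an operator by a contractive net converging strongly to the identity gives a net
converging strongly to that operator. -/
theorem tendsto_mul_mul_apply {ι H : Type*} [NormedAddCommGroup H] [InnerProductSpace ℂ H]
    {l : Filter ι} {e : ι → H →L[ℂ] H} (he : ∀ᶠ i in l, ‖e i‖ ≤ 1)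
    (hx : ∀ x, Tendsto (fun i => e i x) l (𝓝 x)) (T : H →L[ℂ] H) (x : H) :
    Tendsto (fun i => (e i * T * e i) x) l (𝓝 (T x)) := by
  have h0 : Tendsto (fun i => T (e i x) - T x) l (𝓝 0) := by
    simpa using ((T.continuous.tendsto x).comp (hx x)).sub_const (T x)
  have h1 : Tendsto (fun i => e i (T (e i x) - T x)) l (𝓝 0) := by
    refine squeeze_zero_norm' ?_ (by simpa using h0.norm)
    filter_upwards [he] with i hi
    simpa using (e i).le_of_opNorm_le hi (T (e i x) - T x)
  simpa using h1.add (hx (T x))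

/-- Every quasi-centralizer of a nondegenerate C*-subalgebra of `B(H)` is implemented by an
operator on `H`. -/
theorem IsQuasiCentralizer.exists_eq_mul_mul {H : Type*} [NormedAddCommGroup H]
    [InnerProductSpace ℂ H] [CompleteSpace H]
    {A : NonUnitalStarSubalgebra ℂ (H →L[ℂ] H)} (hAc : IsClosed (A : Set (H →L[ℂ] H)))
    (hnd : Dense ((Submodule.span ℂ {ξ : H | ∃ a ∈ A, ∃ η : H, a η = ξ} :
      Submodule ℂ H) : Set H))
    {φ : A → A → A} (hφ : IsQuasiCentralizer A φ) :
    ∃ T : H →L[ℂ] H, ∀ a b : A,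
      ((φ a b : A) : H →L[ℂ] H) = (a : H →L[ℂ] H) * T * (b : H →L[ℂ] H) := by
  obtain ⟨hadd, hsmul, hadd', hsmul', ⟨C, hC⟩, hmul, hmul'⟩ := hφ
  obtain ⟨l, hl, h1, hr, hleft, -⟩ := exists_approximateUnit_tendsto A hAc hnd
  let u := Ultrafilter.of l
  have hu : (u : Filter A) ≤ l := Ultrafilter.of_le l
  have hcont : Continuous fun p : A × A => φ p.1 p.2 :=
    ((LinearMap.mk₂ ℂ φ hadd hsmul hadd' hsmul').mkContinuous₂ C hC).continuous₂
  obtain ⟨T, hT⟩ := exists_tendsto_inner_of_ultrafilter u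
    (fun e => ((φ e e : A) : H →L[ℂ] H)) |C| (by
      filter_upwards [hu h1] with e he
      calc ‖((φ e e : A) : H →L[ℂ] H)‖
          ≤ C * ‖(e : H →L[ℂ] H)‖ * ‖(e : H →L[ℂ] H)‖ := hC e e
        _ ≤ |C| * 1 * 1 := by gcongr; exact le_abs_self C
        _ = |C| := by ring)
  refine ⟨T, fun a b => ?_⟩
  ext x
  refine ext_inner_right ℂ fun y => ?_
  have h_lim : Tendsto (fun e : A => φ (a * e) (e * b)) u (𝓝 (φ a b)) :=
    (hcont.tendsto (a, b)).comp
      (((hleft a).mono_left hu).prodMk_nhds ((hr b).mono_left hu))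
  have hc : Continuous fun c : A => inner ℂ ((c : H →L[ℂ] H) x) y := by fun_prop
  refine tendsto_nhds_unique ((hc.tendsto (φ a b)).comp h_lim) ?_
  have h := hT ((b : H →L[ℂ] H) x) ((a : H →L[ℂ] H).adjoint y)
  simp only [ContinuousLinearMap.adjoint_inner_right] at h
  refine h.congr fun e => ?_
  have he : φ (a * e) (e * b) = a * φ e e * b := by
    rw [hmul', hmul]
  simp only [Function.comp_apply, he]
  rfl

end

/-- Let `A ⊆ B(H)` be a nondegenerately acting C*-subalgebra,
`QM = {T ∈ B(H) : A·T·A ⊆ A}` and `QC` the quasi-centralizers of `A`.  Then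
`Θ : QM → QC`, `Θ(T)(a, b) = a·T·b`, is a well-defined linear bijection, and
it is norm-preserving: `sup {‖a·T·b‖ : ‖a‖ ≤ 1, ‖b‖ ≤ 1} = ‖T‖`. -/
theorem stmt8 {H : Type*} [NormedAddCommGroup H] [InnerProductSpace ℂ H]
    [CompleteSpace H]
    (A : NonUnitalStarSubalgebra ℂ (H →L[ℂ] H)) (hAc : IsClosed (A : Set (H →L[ℂ] H)))
    (hnd : Dense ((Submodule.span ℂ {ξ : H | ∃ a ∈ A, ∃ η : H, a η = ξ} : Submodule ℂ H) : Set H))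
    (QM : Set (H →L[ℂ] H))
    (hQM : QM = {T : H →L[ℂ] H | ∀ a b : A, (a : H →L[ℂ] H) * T * (b : H →L[ℂ] H) ∈ A}) :
    -- well-definedness: each `T ∈ QM` induces a quasi-centralizer `Θ(T)`
    (∀ T : H →L[ℂ] H, ∀ hT : T ∈ QM, IsQuasiCentralizer A
      (fun a b => (⟨(a : H →L[ℂ] H) * T * (b : H →L[ℂ] H), by
        rw [hQM] at hT; exact hT a b⟩ : A))) ∧
    -- linearity of `Θ`
    (∀ (s : ℂ), ∀ T ∈ QM, ∀ T' ∈ QM, s • T + T' ∈ QM ∧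
      ∀ a b : A, (a : H →L[ℂ] H) * (s • T + T') * (b : H →L[ℂ] H) =
        s • ((a : H →L[ℂ] H) * T * (b : H →L[ℂ] H)) +
          (a : H →L[ℂ] H) * T' * (b : H →L[ℂ] H)) ∧
    -- injectivity of `Θ`
    (∀ T ∈ QM, ∀ T' ∈ QM,
      (∀ a b : A, (a : H →L[ℂ] H) * T * (b : H →L[ℂ] H) =
        (a : H →L[ℂ] H) * T' * (b : H →L[ℂ] H)) → T = T') ∧
    -- surjectivity of `Θ`
    (∀ φ : A → A → A, IsQuasiCentralizer A φ → ∃ T ∈ QM, ∀ a b : A,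
      ((φ a b : A) : H →L[ℂ] H) = (a : H →L[ℂ] H) * T * (b : H →L[ℂ] H)) ∧
    -- `Θ` is norm-preserving
    (∀ T ∈ QM, sSup {r : ℝ | ∃ a b : A, ‖(a : H →L[ℂ] H)‖ ≤ 1 ∧
        ‖(b : H →L[ℂ] H)‖ ≤ 1 ∧
        r = ‖(a : H →L[ℂ] H) * T * (b : H →L[ℂ] H)‖} = ‖T‖) := by
  subst hQM
  have hle (T : H →L[ℂ] H) (a b : H →L[ℂ] H) : ‖a * T * b‖ ≤ ‖T‖ * ‖a‖ * ‖b‖ :=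
    (norm_mul_le _ _).trans (by
      rw [mul_comm ‖T‖]
      gcongr
      exact norm_mul_le _ _)
  obtain ⟨l, hl, h1, -, -, hx⟩ := exists_approximateUnit_tendsto A hAc hnd
  refine ⟨fun T hT => ⟨?_, ?_, ?_, ?_, ⟨‖T‖, fun a b => hle T a b⟩, ?_, ?_⟩, ?_, ?_, ?_, ?_⟩
  · intro a b c
    ext1
    simp [add_mul]
  · intro s a b
    ext1
    simp
  · intro a b c
    ext1
    simp [mul_add]
  · intro s a b
    ext1
    simp
  · intro a b c
    ext1
    simp [mul_assoc]
  · intro a b c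
    ext1
    simp [mul_assoc]
  · intro s T hT T' hT'
    have h (a b : H →L[ℂ] H) : a * (s • T + T') * b = s • (a * T * b) + a * T' * b := by
      simp [mul_add, add_mul]
    refine ⟨fun a b => ?_, fun a b => h a b⟩
    rw [h]
    exact add_mem (SMulMemClass.smul_mem s (hT a b)) (hT' a b)
  · intro T _ T' _ h
    ext x
    refine tendsto_nhds_unique (tendsto_mul_mul_apply h1 hx T x) ?_
    exact (tendsto_mul_mul_apply h1 hx T' x).congr fun e => by rw [h]
  · intro φ hφ
    obtain ⟨T, hT⟩ := hφ.exists_eq_mul_mul hAc hnd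
    exact ⟨T, fun a b => hT a b ▸ (φ a b).2, hT⟩
  · intro T _
    have hub : ∀ r ∈ {r : ℝ | ∃ a b : A, ‖(a : H →L[ℂ] H)‖ ≤ 1 ∧ ‖(b : H →L[ℂ] H)‖ ≤ 1 ∧
        r = ‖(a : H →L[ℂ] H) * T * (b : H →L[ℂ] H)‖}, r ≤ ‖T‖ := by
      rintro r ⟨a, b, ha, hb, rfl⟩
      calc ‖(a : H →L[ℂ] H) * T * (b : H →L[ℂ] H)‖
          ≤ ‖T‖ * ‖(a : H →L[ℂ] H)‖ * ‖(b : H →L[ℂ] H)‖ := hle T a b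
        _ ≤ ‖T‖ * 1 * 1 := by gcongr
        _ = ‖T‖ := by ring
    refine le_antisymm (Real.sSup_le hub (norm_nonneg T)) ?_
    refine T.opNorm_le_bound (Real.sSup_nonneg ?_) fun x => ?_
    · rintro r ⟨a, b, -, -, rfl⟩
      exact norm_nonneg _
    · refine le_of_tendsto (tendsto_mul_mul_apply h1 hx T x).norm ?_
      filter_upwards [h1] with e he
      exact ContinuousLinearMap.le_of_opNorm_le _ (le_csSup ⟨‖T‖, hub⟩ ⟨e, e, he, he, rfl⟩) x
end
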